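/- Let f be a k-ary idempotent operation on D = {0,1,2} that preserves {0,2} and {1,2} and satisfies property (*), such that neither Class (i) nor Class (ii) is a singleton, and such that f(x) = 2 for every tuple x ∈ {0,1}^k having x_j = 0 for all j in Class (i) and x_j = 1 for all j in Class (ii) (with arbitrary values in {0,1} on Class (iii)). Then either the clone generated by {f, s} contains a binary idempotent operation q with q(0,1) = 0 and q(0,2) = 2, or it contains a binary idempotent operation q' with q'(0,1) = 1 and q'(2,1) = 2, or the set {f, s} is collapsible. -/

import Mathlib

/-- The three-element domain. -/
abbrev D : Type := Fin 3

/-- A finitary operation on `D`, packaged with its arity. -/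
abbrev Op : Type := Σ n : ℕ, (Fin n → D) → D

/-- The semilattice-without-unit operation `s`: `s(x,x) = x`, `s(x,y) = 2` for `x ≠ y`. -/
def sFun : (Fin 2 → D) → D := fun x => if x 0 = x 1 then x 0 else 2

/-- `s` as a packaged operation. -/
def sOp : Op := ⟨2, sFun⟩

/-- The clone generated by a set `F` of operations on `D`: the smallest set of
operations containing `F` and all projections and closed under composition. -/
inductive InClone (F : Set Op) : Op → Prop
  | base {g : Op} : g ∈ F → InClone F g
  | proj {n : ℕ} (i : Fin n) : InClone F ⟨n, fun x => x i⟩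
  | comp {n m : ℕ} (f : (Fin n → D) → D) (g : Fin n → (Fin m → D) → D) :
      InClone F ⟨n, f⟩ → (∀ i, InClone F ⟨m, g i⟩) →
      InClone F ⟨m, fun x => f (fun i => g i x)⟩

/-- Closure of a set `S ⊆ D^m` under coordinatewise applications of operations
of the clone generated by `F`. -/
inductive InClosure (F : Set Op) {m : ℕ} (S : Set (Fin m → D)) : (Fin m → D) → Prop
  | base {t : Fin m → D} : t ∈ S → InClosure F S t
  | app {n : ℕ} (f : (Fin n → D) → D) (ts : Fin n → Fin m → D) :
      InClone F ⟨n, f⟩ → (∀ i, InClosure F S (ts i)) →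
      InClosure F S (fun j => f (fun i => ts i j))

/-- `Λ_{m,k}`: the tuples of `D^m` in which at least `m - k` coordinates are equal. -/
def Lam (m k : ℕ) : Set (Fin m → D) :=
  {x | ∃ a : D, m - k ≤ Set.ncard {i : Fin m | x i = a}}

/-- `F` is `k`-collapsible. -/
def KCollapsible (F : Set Op) (k : ℕ) : Prop :=
  ∀ m : ℕ, 1 ≤ m → ∀ t : Fin m → D, InClosure F (Lam m k) t

/-- `F` is collapsible: `k`-collapsible for some `k`. -/
def Collapsible (F : Set Op) : Prop := ∃ k, KCollapsible F k

/-- An operation is idempotent. -/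
def Idem {n : ℕ} (g : (Fin n → D) → D) : Prop := ∀ x : D, g (fun _ => x) = x

/-- An operation preserves a subset `B ⊆ D`. -/
def PreservesSet {n : ℕ} (g : (Fin n → D) → D) (B : Set D) : Prop :=
  ∀ x : Fin n → D, (∀ i, x i ∈ B) → g x ∈ B

/-- A tuple lies in `{0,1}^n`. -/
def Bool01 {n : ℕ} (x : Fin n → D) : Prop := ∀ j, x j = 0 ∨ x j = 1

/-- Property (*): for each coordinate `i` there is `x ∈ {0,1}^k` with
`f(x) ∈ {0,1}` and `f(x) ≠ x_i`. -/
def PropStar {k : ℕ} (f : (Fin k → D) → D) : Prop :=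
  ∀ i : Fin k, ∃ x : Fin k → D, Bool01 x ∧ (f x = 0 ∨ f x = 1) ∧ f x ≠ x i

/-- Class (i): coordinates with a `0 ↦ 1` witness but no `1 ↦ 0` witness. -/
def ClassI {k : ℕ} (f : (Fin k → D) → D) : Set (Fin k) :=
  {i | (∃ x, Bool01 x ∧ x i = 0 ∧ f x = 1) ∧ ¬ ∃ x, Bool01 x ∧ x i = 1 ∧ f x = 0}

/-- Class (ii): coordinates with a `1 ↦ 0` witness but no `0 ↦ 1` witness. -/
def ClassII {k : ℕ} (f : (Fin k → D) → D) : Set (Fin k) :=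
  {i | (∃ x, Bool01 x ∧ x i = 1 ∧ f x = 0) ∧ ¬ ∃ x, Bool01 x ∧ x i = 0 ∧ f x = 1}

/-- Substituting the two variables of a binary operation into the coordinates of `f`,
the first one exactly where `x` is `0`. -/
def binaryMinor {k : ℕ} (f : (Fin k → D) → D) (x : Fin k → D) : (Fin 2 → D) → D :=
  fun u => f (fun i => u (if x i = 0 then 0 else 1))

theorem inClone_binaryMinor {k : ℕ} {F : Set Op} {f : (Fin k → D) → D}
    (hf : (⟨k, f⟩ : Op) ∈ F) (x : Fin k → D) : InClone F ⟨2, binaryMinor f x⟩ :=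
  .comp f (fun i u => u (if x i = 0 then 0 else 1)) (.base hf) (fun _ => .proj _)

theorem Idem.binaryMinor {k : ℕ} {f : (Fin k → D) → D} (hf : Idem f) (x : Fin k → D) :
    Idem (binaryMinor f x) := fun d => hf d

theorem binaryMinor_zero_one {k : ℕ} (f : (Fin k → D) → D) {x : Fin k → D} (hx : Bool01 x) :
    binaryMinor f x ![0, 1] = f x := by
  refine congrArg f (funext fun i => ?_)
  rcases hx i with h | h <;> simp [h]

/-- If neither kind of binary operation exists, every coordinate of `f` may be set to `2` in some
tuple over `{a, 2}` that `f` still maps to `a ≠ 2`. -/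
theorem exists_two_witness {k : ℕ} {F : Set Op} {f : (Fin k → D) → D} (hf : (⟨k, f⟩ : Op) ∈ F)
    (hidem : Idem f) (h02 : PreservesSet f {0, 2}) (h12 : PreservesSet f {1, 2})
    (hstar : PropStar f)
    (hq : ¬ ∃ q : (Fin 2 → D) → D, InClone F ⟨2, q⟩ ∧ Idem q ∧ q ![0, 1] = 0 ∧ q ![0, 2] = 2)
    (hq' : ¬ ∃ q : (Fin 2 → D) → D, InClone F ⟨2, q⟩ ∧ Idem q ∧ q ![0, 1] = 1 ∧ q ![2, 1] = 2)
    (i : Fin k) :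
    ∃ (a : D) (y : Fin k → D), (a = 0 ∨ a = 1) ∧ y i = 2 ∧ (∀ l, y l = a ∨ y l = 2) ∧ f y = a := by
  obtain ⟨x, hx, h0 | h1, hne⟩ := hstar i
  · have hi : x i ≠ 0 := fun h => hne (h0.trans h.symm)
    have hy : ∀ l, (![0, 2] : Fin 2 → D) (if x l = 0 then 0 else 1) = 0 ∨
        (![0, 2] : Fin 2 → D) (if x l = 0 then 0 else 1) = 2 := fun l => by
      by_cases h : x l = 0 <;> simp [h]
    refine ⟨0, fun l => (![0, 2] : Fin 2 → D) (if x l = 0 then 0 else 1), .inl rfl, by simp [hi],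
      hy, (h02 _ hy).resolve_right fun h => hq ⟨binaryMinor f x, inClone_binaryMinor hf x,
        hidem.binaryMinor x, (binaryMinor_zero_one f hx).trans h0, h⟩⟩
  · have hi : x i = 0 := (hx i).resolve_right fun h => hne (h1.trans h.symm)
    have hy : ∀ l, (![2, 1] : Fin 2 → D) (if x l = 0 then 0 else 1) = 1 ∨
        (![2, 1] : Fin 2 → D) (if x l = 0 then 0 else 1) = 2 := fun l => by
      by_cases h : x l = 0 <;> simp [h]
    refine ⟨1, fun l => (![2, 1] : Fin 2 → D) (if x l = 0 then 0 else 1), .inr rfl, by simp [hi],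
      hy, (h12 _ hy).resolve_right fun h => hq' ⟨binaryMinor f x, inClone_binaryMinor hf x,
        hidem.binaryMinor x, (binaryMinor_zero_one f hx).trans h1, h⟩⟩

theorem mem_Lam_of_card_ne_le {m k : ℕ} {x : Fin m → D} (a : D)
    (h : (Finset.univ.filter fun i => x i ≠ a).card ≤ k) : x ∈ Lam m k := by
  refine ⟨a, ?_⟩
  have hc := Finset.card_filter_add_card_filter_not (s := (Finset.univ : Finset (Fin m)))
    (fun i => x i = a)
  rw [Finset.card_univ, Fintype.card_fin] at hc
  rw [Set.ncard_eq_toFinset_card', Set.toFinset_ofPred]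
  have h' : (Finset.univ.filter fun i => ¬ x i = a).card ≤ k := h
  omega

theorem InClosure.sFun {F : Set Op} (hs : sOp ∈ F) {m : ℕ} {S : Set (Fin m → D)}
    {x y : Fin m → D} (hx : InClosure F S x) (hy : InClosure F S y) :
    InClosure F S (fun j => if x j = y j then x j else 2) :=
  .app _root_.sFun ![x, y] (.base hs) (Fin.forall_fin_two.2 ⟨hx, hy⟩)

/-- Applying `s` turns any set of coordinates of a tuple with few entries other than `a` into
`2`. -/
theorem inClosure_of_card_le {F : Set Op} (hs : sOp ∈ F) {m k : ℕ} (t : Fin m → D) (a : D)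
    (h : (Finset.univ.filter fun i => t i ≠ a ∧ t i ≠ 2).card ≤ k) :
    InClosure F (Lam m (k + 1)) t := by
  set b : Fin m → D := fun i => if t i = 2 then a else t i with hb
  have hbcard : (Finset.univ.filter fun i => b i ≠ a).card ≤ k := by
    refine (Finset.card_le_card fun i hi => ?_).trans h
    by_cases h2 : t i = 2 <;> simp_all
  have key : ∀ S : Finset (Fin m),
      InClosure F (Lam m (k + 1)) (fun i => if i ∈ S then 2 else b i) := by
    intro S
    induction S using Finset.induction_on with
    | empty => exact .base (mem_Lam_of_card_ne_le a (by simpa using hbcard.trans k.le_succ))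
    | insert j S _ ih =>
      have hj : InClosure F (Lam m (k + 1)) (fun i => if i = j then 2 else b i) := by
        refine .base (mem_Lam_of_card_ne_le a ((Finset.card_le_card fun i hi => ?_).trans
          ((Finset.card_insert_le j (Finset.univ.filter fun i => b i ≠ a)).trans
            (Nat.succ_le_succ hbcard))))
        by_cases hij : i = j
        · simp [hij]
        · simpa [hij] using hi
      convert ih.sFun hs hj using 2 with i
      by_cases hij : i = j <;> by_cases hiS : i ∈ S <;> simp [hij, hiS] <;> grind
  convert key (Finset.univ.filter fun i => t i = 2) using 2 with i
  by_cases h2 : t i = 2 <;> simp [hb, h2]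

theorem exists_injective_of_lt_card {m k : ℕ} {t : Fin m → D} {a : D}
    (h : k < (Finset.univ.filter fun i => t i = a).card) :
    ∃ e : Fin k → Fin m, e.Injective ∧ ∀ i, t (e i) = a := by
  have hc : Fintype.card (Fin k) ≤ Fintype.card {i // t i = a} := by
    simpa [Fintype.card_subtype] using h.le
  obtain ⟨e⟩ := Function.Embedding.nonempty_of_card_le hc
  exact ⟨fun i => e i, fun i j hij => e.injective (Subtype.ext hij), fun i => (e i).2⟩

theorem kCollapsible_of_two_witness {k : ℕ} {F : Set Op} {f : (Fin k → D) → D}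
    (hf : (⟨k, f⟩ : Op) ∈ F) (hs : sOp ∈ F) (hidem : Idem f)
    (hw : ∀ i, ∃ (a : D) (y : Fin k → D),
      (a = 0 ∨ a = 1) ∧ y i = 2 ∧ (∀ l, y l = a ∨ y l = 2) ∧ f y = a) :
    KCollapsible F (k + 1) := by
  choose a y ha hy2 hya hfy using hw
  intro m _ t
  induction hn : (Finset.univ.filter fun j => t j ≠ 2).card using Nat.strong_induction_on
    generalizing t with
  | _ n ih =>
  subst hn
  by_cases h0 : (Finset.univ.filter fun j => t j = 0).card ≤ k
  · refine inClosure_of_card_le hs t 1 ((Finset.card_le_card fun j hj => ?_).trans h0)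
    simp only [Finset.mem_filter, Finset.mem_univ, true_and] at hj ⊢
    lia
  by_cases h1 : (Finset.univ.filter fun j => t j = 1).card ≤ k
  · refine inClosure_of_card_le hs t 0 ((Finset.card_le_card fun j hj => ?_).trans h1)
    simp only [Finset.mem_filter, Finset.mem_univ, true_and] at hj ⊢
    lia
  obtain ⟨e, he, hte⟩ : ∃ e : Fin k → Fin m, e.Injective ∧ ∀ i, t (e i) = a i := by
    obtain ⟨e₀, he₀, ht₀⟩ := exists_injective_of_lt_card (not_le.1 h0)
    obtain ⟨e₁, he₁, ht₁⟩ := exists_injective_of_lt_card (not_le.1 h1)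
    have ht : ∀ i, t (if a i = 0 then e₀ i else e₁ i) = a i := fun i => by
      rcases ha i with h | h <;> simp [h, ht₀, ht₁]
    refine ⟨_, fun i j hij => ?_, ht⟩
    have haij : a i = a j := (ht i).symm.trans ((congrArg t hij).trans (ht j))
    rcases ha j with h | h
    · exact he₀ (by simpa [haij, h] using hij)
    · exact he₁ (by simpa [haij, h] using hij)
  -- The columns of a matrix whose image under `f` is `t` and whose rows have more `2`s than `t`.
  obtain ⟨c, hce, hct⟩ : ∃ c : Fin m → Fin k → D, (∀ i, c (e i) = y i) ∧
      ∀ j, f (c j) = t j ∧ ∀ l, c j l = t j ∨ c j l = 2 := by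
    refine ⟨Function.extend e y fun j _ => t j, fun i => he.extend_apply _ _ i, fun j => ?_⟩
    by_cases hj : ∃ i, e i = j
    · obtain ⟨i, rfl⟩ := hj
      simp only [he.extend_apply, hte]
      exact ⟨hfy i, hya i⟩
    · rw [Function.extend_apply' _ _ _ hj]
      exact ⟨hidem _, fun _ => .inl rfl⟩
  have hrow : ∀ i, InClosure F (Lam m (k + 1)) (fun j => c j i) := by
    refine fun i => ih _ (Finset.card_lt_card ?_) _ rfl
    refine Finset.ssubset_iff_of_subset (fun j hj => ?_) |>.2 ⟨e i, ?_, ?_⟩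
    · have := (hct j).2 i
      simp only [Finset.mem_filter, Finset.mem_univ, true_and] at hj ⊢
      exact fun h => hj (this.elim (fun h' => h'.trans h) id)
    · rcases ha i with h | h <;> simp [hte, h]
    · simp [hce, hy2]
  convert InClosure.app f (fun i j => c j i) (.base hf) hrow using 2 with j
  exact (hct j).1.symm

theorem statement10 {k : ℕ} (f : (Fin k → D) → D)
    (hidem : Idem f)
    (h02 : PreservesSet f {0, 2}) (h12 : PreservesSet f {1, 2})
    (hstar : PropStar f)
    (hI : ¬ ∃ i : Fin k, ClassI f = {i}) (hII : ¬ ∃ i : Fin k, ClassII f = {i})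
    (h2 : ∀ x : Fin k → D, Bool01 x → (∀ j ∈ ClassI f, x j = 0) →
      (∀ j ∈ ClassII f, x j = 1) → f x = 2) :
    (∃ q : (Fin 2 → D) → D, InClone {⟨k, f⟩, sOp} ⟨2, q⟩ ∧ Idem q ∧
      q ![0, 1] = 0 ∧ q ![0, 2] = 2) ∨
    (∃ q' : (Fin 2 → D) → D, InClone {⟨k, f⟩, sOp} ⟨2, q'⟩ ∧ Idem q' ∧
      q' ![0, 1] = 1 ∧ q' ![2, 1] = 2) ∨
    Collapsible {⟨k, f⟩, sOp} := by
  by_cases hq : ∃ q : (Fin 2 → D) → D, InClone {⟨k, f⟩, sOp} ⟨2, q⟩ ∧ Idem q ∧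
      q ![0, 1] = 0 ∧ q ![0, 2] = 2
  · exact .inl hq
  by_cases hq' : ∃ q' : (Fin 2 → D) → D, InClone {⟨k, f⟩, sOp} ⟨2, q'⟩ ∧ Idem q' ∧
      q' ![0, 1] = 1 ∧ q' ![2, 1] = 2
  · exact .inr (.inl hq')
  have hf : (⟨k, f⟩ : Op) ∈ ({⟨k, f⟩, sOp} : Set Op) := .inl rfl
  exact .inr (.inr ⟨k + 1, kCollapsible_of_two_witness hf (.inr rfl) hidem
    (exists_two_witness hf hidem h02 h12 hstar hq hq')⟩)
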